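/- Commutators with the shift operators: [Λ_Z̃, Ỹ_+] = Ỹ_+ Δ and [Λ_Ỹ, Z̃_+] = Z̃_+ Δ on 𝒫_{Ỹ,Z̃}, i.e. for every f ∈ 𝒫_{Ỹ,Z̃}, Λ_Z̃(Ỹ_+ f) − Ỹ_+(Λ_Z̃ f) = Ỹ_+(Δ f) and Λ_Ỹ(Z̃_+ f) − Z̃_+(Λ_Ỹ f) = Z̃_+(Δ f). -/

import Mathlib

open MvPolynomial

noncomputable section

/-- The base field `K = ℚ(b)`: rational functions in an indeterminate `b` over `ℚ`. -/
abbrev K : Type := RatFunc ℚ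

/-- The indeterminate `b ∈ K`. -/
def bb : K := RatFunc.X

/-- `α = 1 + b`. -/
def alpha : K := 1 + bb

/-- Variables: `p i` (used for `i ≥ 1`) and `y i`, `y' i`, `z i`, `z' i` (`i ≥ 0`). -/
inductive Var : Type
  | p : ℕ → Var
  | y : ℕ → Var
  | y' : ℕ → Var
  | z : ℕ → Var
  | z' : ℕ → Var
  deriving DecidableEq

/-- The ambient polynomial ring `R′`. -/
abbrev R : Type := MvPolynomial Var K

/-- The generic operator
`Λ_A = α Σ_{i,j≥1} i a_{i+j−1} ∂²/∂p_i∂a_{j−1} + Σ_{i,j≥1} a_{i−1} p_j ∂/∂a_{i+j−1}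
     + b Σ_{i≥1} i a_i ∂/∂a_i` for the alphabet `a ∈ {y, y′, z, z′}`. -/
def Lam (a : ℕ → Var) (f : R) : R :=
  alpha • (∑ᶠ (i : ℕ) (j : ℕ), ((i + 1 : ℕ) : K) •
      (X (a (i + j + 1)) * pderiv (Var.p (i + 1)) (pderiv (a j) f)))
    + (∑ᶠ (i : ℕ) (j : ℕ), X (a i) * X (Var.p (j + 1)) * pderiv (a (i + j + 1)) f)
    + bb • (∑ᶠ (i : ℕ), ((i + 1 : ℕ) : K) • (X (a (i + 1)) * pderiv (a (i + 1)) f))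

/-- The generic shift operator `A_+ = Σ_{i≥0} a_{i+1} ∂/∂a_i`. -/
def Plus (a : ℕ → Var) (f : R) : R := ∑ᶠ (i : ℕ), X (a (i + 1)) * pderiv (a i) f

/-- The generic operator `Θ_A = Σ_{i≥1} p_i ∂/∂a_i`. -/
def Theta (a : ℕ → Var) (f : R) : R := ∑ᶠ (i : ℕ), X (Var.p (i + 1)) * pderiv (a (i + 1)) f

/-- `M_Z = α Σ_{i,j,k≥1} y′_{i+j−1} z′_{k−1} ∂²/∂y_{i+k−1}∂z_{j−1}
         + Σ_{i,j,k≥1} y_{i+j−1} z_{k−1} ∂²/∂y′_{i+k−1}∂z′_{j−1}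
         + b Σ_{i,j,k≥1} y′_{i+j−1} z′_{k−1} ∂²/∂y′_{i+k−1}∂z′_{j−1}`. -/
def MZ (f : R) : R :=
  alpha • (∑ᶠ (i : ℕ) (j : ℕ) (k : ℕ), X (Var.y' (i + j + 1)) * X (Var.z' k) *
      pderiv (Var.y (i + k + 1)) (pderiv (Var.z j) f))
    + (∑ᶠ (i : ℕ) (j : ℕ) (k : ℕ), X (Var.y (i + j + 1)) * X (Var.z k) *
      pderiv (Var.y' (i + k + 1)) (pderiv (Var.z' j) f))
    + bb • (∑ᶠ (i : ℕ) (j : ℕ) (k : ℕ), X (Var.y' (i + j + 1)) * X (Var.z' k) *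
      pderiv (Var.y' (i + k + 1)) (pderiv (Var.z' j) f))

/-- `M_Y`: obtained from `M_Z` by exchanging `y ↔ z` and `y′ ↔ z′` everywhere. -/
def MY (f : R) : R :=
  alpha • (∑ᶠ (i : ℕ) (j : ℕ) (k : ℕ), X (Var.z' (i + j + 1)) * X (Var.y' k) *
      pderiv (Var.z (i + k + 1)) (pderiv (Var.y j) f))
    + (∑ᶠ (i : ℕ) (j : ℕ) (k : ℕ), X (Var.z (i + j + 1)) * X (Var.y k) *
      pderiv (Var.z' (i + k + 1)) (pderiv (Var.y' j) f))
    + bb • (∑ᶠ (i : ℕ) (j : ℕ) (k : ℕ), X (Var.z' (i + j + 1)) * X (Var.y' k) *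
      pderiv (Var.z' (i + k + 1)) (pderiv (Var.y' j) f))

/-- `Λ_Ỹ = Λ_Y + Λ_{Y′} + M_Y`. -/
def LamYt (f : R) : R := Lam Var.y f + Lam Var.y' f + MY f

/-- `Λ_Z̃ = Λ_Z + Λ_{Z′} + M_Z`. -/
def LamZt (f : R) : R := Lam Var.z f + Lam Var.z' f + MZ f

/-- `Ỹ_+ = Y_+ + Y′_+`. -/
def Ytplus (f : R) : R := Plus Var.y f + Plus Var.y' f

/-- `Z̃_+ = Z_+ + Z′_+`. -/
def Ztplus (f : R) : R := Plus Var.z f + Plus Var.z' f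

/-- `Θ_Z̃ = ∂/∂z₀ + Σ_{i≥1} p_i ∂/∂z_i + Σ_{i,j≥0} y_{i+j} ∂²/∂y′_i∂z′_j`. -/
def ThZt (f : R) : R :=
  pderiv (Var.z 0) f + (∑ᶠ (i : ℕ), X (Var.p (i + 1)) * pderiv (Var.z (i + 1)) f)
    + (∑ᶠ (i : ℕ) (j : ℕ), X (Var.y (i + j)) * pderiv (Var.y' i) (pderiv (Var.z' j) f))

/-- `Θ_Ỹ = ∂/∂y₀ + Σ_{i≥1} p_i ∂/∂y_i + Σ_{i,j≥0} z_{i+j} ∂²/∂z′_i∂y′_j`. -/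
def ThYt (f : R) : R :=
  pderiv (Var.y 0) f + (∑ᶠ (i : ℕ), X (Var.p (i + 1)) * pderiv (Var.y (i + 1)) f)
    + (∑ᶠ (i : ℕ) (j : ℕ), X (Var.z (i + j)) * pderiv (Var.z' i) (pderiv (Var.y' j) f))

/-- `Δ = α Σ_{i,j≥0} z′_i y′_j ∂²/∂y_i∂z_j + Σ_{i,j≥0} z_i y_j ∂²/∂y′_i∂z′_j
      + b Σ_{i,j≥0} z′_i y′_j ∂²/∂y′_i∂z′_j`. -/
def Delta (f : R) : R :=
  alpha • (∑ᶠ (i : ℕ) (j : ℕ), X (Var.z' i) * X (Var.y' j) *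
      pderiv (Var.y i) (pderiv (Var.z j) f))
    + (∑ᶠ (i : ℕ) (j : ℕ), X (Var.z i) * X (Var.y j) *
      pderiv (Var.y' i) (pderiv (Var.z' j) f))
    + bb • (∑ᶠ (i : ℕ) (j : ℕ), X (Var.z' i) * X (Var.y' j) *
      pderiv (Var.y' i) (pderiv (Var.z' j) f))

/-- `𝒫`: the subalgebra of polynomials in the `p`-variables only. -/
def Psub : Subalgebra K R := MvPolynomial.supported K (Set.range Var.p)

/-- `𝒫_Y`: the `K`-linear span of the monomials `p_λ` and `y_i·p_λ`. -/
def PY : Submodule K R :=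
  Submodule.span K ((Psub : Set R) ∪
    {g : R | ∃ i : ℕ, ∃ f ∈ (Psub : Set R), g = X (Var.y i) * f})

/-- `𝒫_{Ỹ,Z̃}`: the `K`-linear span of the monomials
`p_λ, y_i·p_λ, z_j·p_λ, y_i·z_j·p_λ, y′_i·p_λ, z′_j·p_λ, y′_i·z′_j·p_λ`. -/
def PYZt : Submodule K R :=
  Submodule.span K ((Psub : Set R) ∪
    {g : R | ∃ f ∈ (Psub : Set R),
      (∃ i : ℕ, g = X (Var.y i) * f) ∨ (∃ j : ℕ, g = X (Var.z j) * f) ∨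
      (∃ i : ℕ, ∃ j : ℕ, g = X (Var.y i) * X (Var.z j) * f) ∨
      (∃ i : ℕ, g = X (Var.y' i) * f) ∨ (∃ j : ℕ, g = X (Var.z' j) * f) ∨
      (∃ i : ℕ, ∃ j : ℕ, g = X (Var.y' i) * X (Var.z' j) * f)})

/-- The index carried by a variable. -/
def Var.idx : Var → ℕ
  | .p n => n
  | .y n => n
  | .y' n => n
  | .z n => n
  | .z' n => n

theorem exists_idx_bound (f : R) : ∃ N, ∀ v : Var, N ≤ v.idx → pderiv v f = 0 := by
  refine ⟨f.vars.sup Var.idx + 1, fun v hv => pderiv_eq_zero_of_notMem_vars fun hmem => ?_⟩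
  have := Finset.le_sup (f := Var.idx) hmem
  omega

theorem exists_common_idx_bound (f g : R) :
    ∃ N, (∀ v : Var, N ≤ v.idx → pderiv v f = 0) ∧ ∀ v : Var, N ≤ v.idx → pderiv v g = 0 := by
  obtain ⟨N, hN⟩ := exists_idx_bound f
  obtain ⟨M, hM⟩ := exists_idx_bound g
  exact ⟨max N M, fun v hv => hN v (le_trans (le_max_left _ _) hv),
    fun v hv => hM v (le_trans (le_max_right _ _) hv)⟩

section Finsum

variable {A : Type*} [AddCommMonoid A]

theorem finsum_eq_sum_range (N : ℕ) (F : ℕ → A) (h : ∀ i, N ≤ i → F i = 0) :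
    ∑ᶠ i, F i = ∑ i ∈ Finset.range N, F i := by
  refine finsum_eq_sum_of_support_subset _ fun i hi => ?_
  by_contra hlt
  exact hi (h i (by simpa using hlt))

theorem finsum_eq_sum_range₂ (N : ℕ) (F : ℕ → ℕ → A)
    (h : ∀ i j, N ≤ i ∨ N ≤ j → F i j = 0) :
    ∑ᶠ (i : ℕ) (j : ℕ), F i j = ∑ i ∈ Finset.range N, ∑ j ∈ Finset.range N, F i j := by
  have h₁ : ∀ i, ∑ᶠ j, F i j = ∑ j ∈ Finset.range N, F i j := fun i =>
    finsum_eq_sum_range N _ fun j hj => h i j (Or.inr hj)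
  simp_rw [h₁]
  exact finsum_eq_sum_range N _ fun i hi => Finset.sum_eq_zero fun j _ => h i j (Or.inl hi)

theorem finsum_eq_sum_range₃ (N : ℕ) (F : ℕ → ℕ → ℕ → A)
    (h : ∀ i j k, N ≤ i ∨ N ≤ j ∨ N ≤ k → F i j k = 0) :
    ∑ᶠ (i : ℕ) (j : ℕ) (k : ℕ), F i j k =
      ∑ i ∈ Finset.range N, ∑ j ∈ Finset.range N, ∑ k ∈ Finset.range N, F i j k := by
  have h₁ : ∀ i, ∑ᶠ (j : ℕ) (k : ℕ), F i j k =
      ∑ j ∈ Finset.range N, ∑ k ∈ Finset.range N, F i j k := fun i =>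
    finsum_eq_sum_range₂ N _ fun j k hjk => h i j k (Or.inr hjk)
  simp_rw [h₁]
  exact finsum_eq_sum_range N _ fun i hi =>
    Finset.sum_eq_zero fun j _ => Finset.sum_eq_zero fun k _ => h i j k (Or.inl hi)

end Finsum

theorem pderiv_apply_derivation (D E : Derivation K R R) (v : Var)
    (h : ∀ w, pderiv v (D (X w)) = E (X w)) (f : R) :
    pderiv v (D f) = D (pderiv v f) + E f := by
  have key : ⁅pderiv (R := K) v, D⁆ = E := by
    refine derivation_ext fun w => ?_
    have hc : D (pderiv v (X w)) = 0 := by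
      rw [pderiv_X]
      by_cases hw : w = v
      · subst hw; simp
      · simp [Pi.single_eq_of_ne hw]
    rw [Derivation.commutator_apply, hc, sub_zero, h]
  rw [← key, Derivation.commutator_apply]
  abel

theorem pderiv_apply_derivation_of_eq_zero (D : Derivation K R R) (v : Var)
    (h : ∀ w, pderiv v (D (X w)) = 0) (f : R) : pderiv v (D f) = D (pderiv v f) := by
  simpa using pderiv_apply_derivation D (0 : Derivation K R R) v (by simpa using h) f

theorem pderiv_pderiv_comm (v w : Var) (f : R) :
    pderiv v (pderiv w f) = pderiv w (pderiv v f) := by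
  refine pderiv_apply_derivation_of_eq_zero (pderiv w) v (fun u => ?_) f
  rw [pderiv_X]
  by_cases hu : u = w
  · subst hu; simp
  · simp [Pi.single_eq_of_ne hu]

/-- The shift of the alphabet `a`, as a derivation. -/
def shift (a : ℕ → Var) : Derivation K R R := mkDerivation K fun v => Plus a (X v)

theorem shift_X_self {a : ℕ → Var} (ha : ∀ n, (a n).idx = n) (n : ℕ) :
    shift a (X (a n)) = X (a (n + 1)) := by
  rw [shift, mkDerivation_X, Plus, finsum_eq_single _ n]
  · simp
  · intro i hi
    have : a n ≠ a i := fun h => hi (by rw [← ha i, ← h, ha])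
    simp [pderiv_X, Pi.single_eq_of_ne this]

theorem shift_X_of_ne {a : ℕ → Var} {v : Var} (h : ∀ n, a n ≠ v) : shift a (X v) = 0 := by
  rw [shift, mkDerivation_X, Plus]
  simp [pderiv_X, Pi.single_eq_of_ne (h _).symm]

theorem plus_eq_shift {a : ℕ → Var} (ha : ∀ n, (a n).idx = n) (f : R) :
    Plus a f = shift a f := by
  have sum_apply : ∀ (N : ℕ) (E : ℕ → Derivation K R R) (g : R),
      (∑ i ∈ Finset.range N, E i) g = ∑ i ∈ Finset.range N, E i g := fun N E g =>
    map_sum ((Pi.evalAddMonoidHom (fun _ : R => R) g).comp Derivation.coeFnAddMonoidHom) E _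
  set N := f.vars.sup Var.idx + 1
  have hlt : ∀ v ∈ f.vars, v.idx < N := fun v hv =>
    Nat.lt_succ_of_le (Finset.le_sup (f := Var.idx) hv)
  have key : shift a f =
      (∑ i ∈ Finset.range N, (X (a (i + 1)) : R) • pderiv (R := K) (a i)) f := by
    refine derivation_eq_of_forall_mem_vars fun v hv => ?_
    rw [sum_apply, shift, mkDerivation_X, Plus, finsum_eq_sum_range N]
    · simp
    · intro i hi
      have : v ≠ a i := fun h => by
        have := hlt v hv
        rw [h, ha] at this
        omega
      simp [pderiv_X, Pi.single_eq_of_ne this]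
  rw [key, sum_apply, Plus, finsum_eq_sum_range N]
  · simp
  · intro i hi
    rw [pderiv_eq_zero_of_notMem_vars, mul_zero]
    intro hmem
    have := hlt _ hmem
    rw [ha] at this
    omega

/-- A derivation that does not see the variables `c` and `p` commutes with `Lam c`. -/
theorem Lam_derivation {c : ℕ → Var} (hc : ∀ n, (c n).idx = n) (D : Derivation K R R)
    (hDc : ∀ n, D (X (c n)) = 0) (hDp : ∀ n, D (X (Var.p n)) = 0)
    (hcD : ∀ n g, pderiv (c n) (D g) = D (pderiv (c n) g))
    (hpD : ∀ n g, pderiv (Var.p n) (D g) = D (pderiv (Var.p n) g)) (f : R) :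
    Lam c (D f) = D (Lam c f) := by
  have expand : ∀ (g : R) (N : ℕ), (∀ v : Var, N ≤ v.idx → pderiv v g = 0) →
      Lam c g =
        alpha • (∑ i ∈ Finset.range N, ∑ j ∈ Finset.range N, ((i + 1 : ℕ) : K) •
          (X (c (i + j + 1)) * pderiv (Var.p (i + 1)) (pderiv (c j) g)))
        + (∑ i ∈ Finset.range N, ∑ j ∈ Finset.range N,
          X (c i) * X (Var.p (j + 1)) * pderiv (c (i + j + 1)) g)
        + bb • (∑ i ∈ Finset.range N,
          ((i + 1 : ℕ) : K) • (X (c (i + 1)) * pderiv (c (i + 1)) g)) := by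
    intro g N hg
    rw [Lam, finsum_eq_sum_range₂ N, finsum_eq_sum_range₂ N, finsum_eq_sum_range N]
    · intro i hi
      rw [hg _ (by rw [hc]; omega), mul_zero, smul_zero]
    · intro i j hij
      rw [hg _ (by rw [hc]; omega), mul_zero]
    · rintro i j (hi | hj)
      · rw [pderiv_pderiv_comm, hg _ (by simp only [Var.idx]; omega), map_zero, mul_zero,
          smul_zero]
      · rw [hg _ (by rw [hc]; omega), map_zero, mul_zero, smul_zero]
  obtain ⟨N, hf, hDf⟩ := exists_common_idx_bound f (D f)
  rw [expand f N hf, expand (D f) N hDf]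
  simp only [map_add, map_sum, Derivation.map_smul, Derivation.leibniz, hDc, hDp, hcD, hpD,
    mul_zero, add_zero, smul_eq_mul]

/-- The summand of the mixed operators `M_Z`, `M_Y` attached to a choice of alphabets. -/
def mixed (u u' w w' : ℕ → Var) (f : R) : R :=
  ∑ᶠ (i : ℕ) (j : ℕ) (k : ℕ), X (u' (i + j + 1)) * X (w' k) *
    pderiv (u (i + k + 1)) (pderiv (w j) f)

/-- The summand of the operator `Δ` attached to a choice of alphabets. -/
def crossed (u u' w w' : ℕ → Var) (f : R) : R :=
  ∑ᶠ (i : ℕ) (j : ℕ), X (w' i) * X (u' j) * pderiv (u i) (pderiv (w j) f)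

section Mixed

variable {u u' w w' : ℕ → Var}

theorem crossed_eq_sum (hu : ∀ n, (u n).idx = n) (hw : ∀ n, (w n).idx = n) {f : R} {N : ℕ}
    (hf : ∀ v : Var, N ≤ v.idx → pderiv v f = 0) :
    crossed u u' w w' f = ∑ i ∈ Finset.range N, ∑ j ∈ Finset.range N,
      X (w' i) * X (u' j) * pderiv (u i) (pderiv (w j) f) := by
  refine finsum_eq_sum_range₂ N _ ?_
  rintro i j (hi | hj)
  · rw [pderiv_pderiv_comm, hf (u i) (by rwa [hu]), map_zero, mul_zero]
  · rw [hf (w j) (by rwa [hw]), map_zero, mul_zero]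

theorem crossed_swap (hu : ∀ n, (u n).idx = n) (hw : ∀ n, (w n).idx = n) (f : R) :
    crossed u u' w w' f = crossed w w' u u' f := by
  obtain ⟨N, hf⟩ := exists_idx_bound f
  rw [crossed_eq_sum hu hw hf, crossed_eq_sum hw hu hf, Finset.sum_comm]
  refine Finset.sum_congr rfl fun i _ => Finset.sum_congr rfl fun j _ => ?_
  rw [pderiv_pderiv_comm, mul_comm (X (w' j))]

theorem mixed_eq_sum (hu : ∀ n, (u n).idx = n) (hw : ∀ n, (w n).idx = n) {f : R} {N : ℕ}
    (hf : ∀ v : Var, N ≤ v.idx → pderiv v f = 0) :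
    mixed u u' w w' f = ∑ i ∈ Finset.range N, ∑ j ∈ Finset.range N, ∑ k ∈ Finset.range N,
      X (u' (i + j + 1)) * X (w' k) * pderiv (u (i + k + 1)) (pderiv (w j) f) := by
  refine finsum_eq_sum_range₃ N _ fun i j k hijk => ?_
  by_cases hj : N ≤ j
  · rw [hf (w j) (by rwa [hw]), map_zero, mul_zero]
  · rw [pderiv_pderiv_comm, hf (u (i + k + 1)) (by rw [hu]; omega), map_zero, mul_zero]

/-- The commutator of a mixed operator with a shift telescopes. -/
theorem mixed_derivation (hu : ∀ n, (u n).idx = n) (hw : ∀ n, (w n).idx = n)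
    (D : Derivation K R R) (hDu' : ∀ n, D (X (u' n)) = X (u' (n + 1)))
    (hDw' : ∀ n, D (X (w' n)) = 0)
    (huD : ∀ n g, pderiv (u (n + 1)) (D g) = D (pderiv (u (n + 1)) g) + pderiv (u n) g)
    (hwD : ∀ n g, pderiv (w n) (D g) = D (pderiv (w n) g)) {f : R}
    (hf : ∀ i j, D (pderiv (u i) (pderiv (w j) f)) = 0) :
    mixed u u' w w' (D f) - D (mixed u u' w w' f) = D (crossed u u' w w' f) := by
  obtain ⟨N, hN, hDN⟩ := exists_common_idx_bound f (D f)
  rw [mixed_eq_sum hu hw hN, mixed_eq_sum hu hw hDN, crossed_eq_sum hu hw hN]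
  simp only [map_sum, ← Finset.sum_sub_distrib]
  rw [Finset.sum_comm, Finset.sum_comm (f := fun i j =>
    D (X (w' i) * X (u' j) * pderiv (u i) (pderiv (w j) f)))]
  refine Finset.sum_congr rfl fun j _ => ?_
  rw [Finset.sum_comm]
  refine Finset.sum_congr rfl fun k _ => ?_
  let G : ℕ → R := fun i =>
    X (u' (i + j + 1)) * X (w' k) * pderiv (u (i + k)) (pderiv (w j) f)
  have hG : ∀ i, X (u' (i + j + 1)) * X (w' k) * pderiv (u (i + k + 1)) (pderiv (w j) (D f)) -
      D (X (u' (i + j + 1)) * X (w' k) * pderiv (u (i + k + 1)) (pderiv (w j) f)) =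
      G i - G (i + 1) := by
    intro i
    simp only [G, hwD, huD, Derivation.leibniz, hDu', hDw', hf, smul_eq_mul,
      show i + 1 + j + 1 = i + j + 1 + 1 by omega, show i + 1 + k = i + k + 1 by omega]
    ring
  have hGN : G N = 0 := by
    simp only [G]
    rw [pderiv_pderiv_comm, hN (u (N + k)) (by rw [hu]; omega), map_zero, mul_zero]
  rw [Finset.sum_congr rfl fun i _ => hG i, Finset.sum_range_sub', hGN]
  simp only [G, Derivation.leibniz, hDu', hDw', hf, smul_eq_mul, zero_add]
  ring

end Mixed

theorem MZ_eq_mixed (f : R) : MZ f =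
    alpha • mixed Var.y Var.y' Var.z Var.z' f + mixed Var.y' Var.y Var.z' Var.z f
      + bb • mixed Var.y' Var.y' Var.z' Var.z' f := rfl

theorem MY_eq_mixed (f : R) : MY f =
    alpha • mixed Var.z Var.z' Var.y Var.y' f + mixed Var.z' Var.z Var.y' Var.y f
      + bb • mixed Var.z' Var.z' Var.y' Var.y' f := rfl

theorem Delta_eq_crossed (f : R) : Delta f =
    alpha • crossed Var.y Var.y' Var.z Var.z' f + crossed Var.y' Var.y Var.z' Var.z f
      + bb • crossed Var.y' Var.y' Var.z' Var.z' f := rfl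

theorem Delta_eq_crossed_swap (f : R) : Delta f =
    alpha • crossed Var.z Var.z' Var.y Var.y' f + crossed Var.z' Var.z Var.y' Var.y f
      + bb • crossed Var.z' Var.z' Var.y' Var.y' f := by
  rw [Delta_eq_crossed, crossed_swap (u := Var.y) (fun _ => rfl) (fun _ => rfl),
    crossed_swap (u := Var.y') (u' := Var.y) (fun _ => rfl) (fun _ => rfl),
    crossed_swap (u := Var.y') (u' := Var.y') (fun _ => rfl) (fun _ => rfl)]

theorem pderiv_eq_zero_of_mem_Psub {v : Var} (hv : ∀ n, Var.p n ≠ v) {g : R} (hg : g ∈ Psub) :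
    pderiv v g = 0 := by
  refine pderiv_eq_zero_of_notMem_vars fun hmem => ?_
  obtain ⟨n, hn⟩ := mem_supported.1 hg hmem
  exact hv n hn

theorem derivation_eq_zero_of_mem_Psub {D : Derivation K R R}
    (hD : ∀ n, D (X (Var.p n)) = 0) {g : R} (hg : g ∈ Psub) : D g = 0 := by
  refine (derivation_eq_of_forall_mem_vars (D₂ := (0 : Derivation K R R)) fun v hv => ?_)
  obtain ⟨n, rfl⟩ := mem_supported.1 hg hv
  simpa using hD n

/-- The derivatives that occur in `Δ` map `𝒫_{Ỹ,Z̃}` to `𝒫`. -/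
theorem pderiv_pderiv_mem_Psub {f : R} (hf : f ∈ PYZt) (i j : ℕ) :
    pderiv (Var.y i) (pderiv (Var.z j) f) ∈ Psub ∧
      pderiv (Var.y' i) (pderiv (Var.z' j) f) ∈ Psub := by
  induction hf using Submodule.span_induction with
  | zero => simp [zero_mem]
  | add f g _ _ hf hg =>
    simp only [map_add]
    exact ⟨add_mem hf.1 hg.1, add_mem hf.2 hg.2⟩
  | smul r f _ hf =>
    simp only [Derivation.map_smul]
    exact ⟨Subalgebra.smul_mem _ hf.1 r, Subalgebra.smul_mem _ hf.2 r⟩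
  | mem f hf =>
    have hy : ∀ n, ∀ g ∈ Psub, pderiv (Var.y n) g = 0 := fun n g hg =>
      pderiv_eq_zero_of_mem_Psub (by simp) hg
    have hy' : ∀ n, ∀ g ∈ Psub, pderiv (Var.y' n) g = 0 := fun n g hg =>
      pderiv_eq_zero_of_mem_Psub (by simp) hg
    have hz : ∀ n, ∀ g ∈ Psub, pderiv (Var.z n) g = 0 := fun n g hg =>
      pderiv_eq_zero_of_mem_Psub (by simp) hg
    have hz' : ∀ n, ∀ g ∈ Psub, pderiv (Var.z' n) g = 0 := fun n g hg =>
      pderiv_eq_zero_of_mem_Psub (by simp) hg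
    rcases hf with hf | ⟨g, hg, hf⟩
    · rw [hz _ _ hf, hz' _ _ hf]
      simp [zero_mem]
    · have hg : g ∈ Psub := hg
      rcases hf with ⟨m, rfl⟩ | ⟨m, rfl⟩ | ⟨m, n, rfl⟩ | ⟨m, rfl⟩ | ⟨m, rfl⟩ | ⟨m, n, rfl⟩ <;>
      simp only [Derivation.leibniz, pderiv_X, hz _ _ hg, hz' _ _ hg,
        Pi.single_apply, Var.z.injEq, Var.z'.injEq, reduceCtorEq,
        if_false, smul_eq_mul, mul_zero, add_zero, zero_add, mul_ite, mul_one, map_zero] <;>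
      (try split_ifs) <;>
      simp [zero_mem, hy _ _ hg, hy' _ _ hg, pderiv_X, Pi.single_apply] <;>
      split_ifs <;>
      simp [zero_mem, hg]

/-- The commutation rules between the partial derivatives and the sum of the shifts of two
alphabets `a`, `a'`. -/
theorem pderiv_shift_add_shift {a a' : ℕ → Var} (ha : ∀ n, (a n).idx = n)
    (ha' : ∀ n, (a' n).idx = n) (haa' : ∀ m n, a m ≠ a' n) (n : ℕ) (g : R) :
    pderiv (a (n + 1)) ((shift a + shift a') g) =
      (shift a + shift a') (pderiv (a (n + 1)) g) + pderiv (a n) g := by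
  refine pderiv_apply_derivation _ _ _ (fun w => ?_) g
  by_cases hw : ∃ m, a m = w
  · obtain ⟨m, rfl⟩ := hw
    rw [Derivation.add_apply, shift_X_self ha, shift_X_of_ne fun k => (haa' m k).symm, add_zero,
      pderiv_X, pderiv_X]
    have inj : ∀ k l, a k = a l ↔ k = l := fun k l =>
      ⟨fun h => by rw [← ha k, h, ha], fun h => h ▸ rfl⟩
    simp [Pi.single_apply, inj]
  · push Not at hw
    rw [Derivation.add_apply, shift_X_of_ne hw, zero_add, pderiv_X_of_ne (hw n).symm]
    by_cases hw' : ∃ m, a' m = w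
    · obtain ⟨m, rfl⟩ := hw'
      rw [shift_X_self ha', pderiv_X_of_ne (haa' _ _).symm]
    · push Not at hw'
      rw [shift_X_of_ne hw', map_zero]

theorem pderiv_shift_comm {a : ℕ → Var} (ha : ∀ n, (a n).idx = n) {v : Var}
    (hv : ∀ n, a n ≠ v) (g : R) : pderiv v (shift a g) = shift a (pderiv v g) := by
  refine pderiv_apply_derivation_of_eq_zero _ _ (fun w => ?_) g
  by_cases hw : ∃ m, a m = w
  · obtain ⟨m, rfl⟩ := hw
    rw [shift_X_self ha, pderiv_X_of_ne (hv _)]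
  · push Not at hw
    rw [shift_X_of_ne hw, map_zero]

/-- The commutator relation for abstract alphabets: `a, a'` are shifted and `c, c'` are not. -/
theorem commutator_with_shift {a a' c c' : ℕ → Var} (ha : ∀ n, (a n).idx = n)
    (ha' : ∀ n, (a' n).idx = n) (hc : ∀ n, (c n).idx = n) (hc' : ∀ n, (c' n).idx = n)
    (haa' : ∀ m n, a m ≠ a' n) (hac : ∀ m n, a m ≠ c n) (hac' : ∀ m n, a m ≠ c' n)
    (ha'c : ∀ m n, a' m ≠ c n) (ha'c' : ∀ m n, a' m ≠ c' n) (hap : ∀ m n, a m ≠ Var.p n)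
    (ha'p : ∀ m n, a' m ≠ Var.p n) {f : R}
    (hf : ∀ i j, pderiv (a i) (pderiv (c j) f) ∈ Psub)
    (hf' : ∀ i j, pderiv (a' i) (pderiv (c' j) f) ∈ Psub) (D : Derivation K R R)
    (hD : D = shift a + shift a') :
    Lam c (D f) + Lam c' (D f) + (alpha • mixed a a' c c' (D f) + mixed a' a c' c (D f)
        + bb • mixed a' a' c' c' (D f))
      - D (Lam c f + Lam c' f + (alpha • mixed a a' c c' f + mixed a' a c' c f
        + bb • mixed a' a' c' c' f)) =
    D (alpha • crossed a a' c c' f + crossed a' a c' c f + bb • crossed a' a' c' c' f) := by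
  have hX : ∀ v, (∀ n, a n ≠ v) → (∀ n, a' n ≠ v) → D (X v) = 0 := fun v h h' => by
    rw [hD, Derivation.add_apply, shift_X_of_ne h, shift_X_of_ne h', add_zero]
  have hcomm : ∀ v, (∀ n, a n ≠ v) → (∀ n, a' n ≠ v) →
      ∀ g, pderiv v (D g) = D (pderiv v g) := fun v h h' g => by
    simp only [hD, Derivation.add_apply, map_add, pderiv_shift_comm ha h,
      pderiv_shift_comm ha' h']
  have hDp : ∀ n, D (X (Var.p n)) = 0 := fun n => hX _ (hap · n) (ha'p · n)
  have hDc : ∀ n, D (X (c n)) = 0 := fun n => hX _ (hac · n) (ha'c · n)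
  have hDc' : ∀ n, D (X (c' n)) = 0 := fun n => hX _ (hac' · n) (ha'c' · n)
  have hcD : ∀ n g, pderiv (c n) (D g) = D (pderiv (c n) g) := fun n =>
    hcomm _ (hac · n) (ha'c · n)
  have hc'D : ∀ n g, pderiv (c' n) (D g) = D (pderiv (c' n) g) := fun n =>
    hcomm _ (hac' · n) (ha'c' · n)
  have hpD : ∀ n g, pderiv (Var.p n) (D g) = D (pderiv (Var.p n) g) := fun n =>
    hcomm _ (hap · n) (ha'p · n)
  have hDa : ∀ n, D (X (a n)) = X (a (n + 1)) := fun n => by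
    rw [hD, Derivation.add_apply, shift_X_self ha, shift_X_of_ne fun k => (haa' n k).symm,
      add_zero]
  have hDa' : ∀ n, D (X (a' n)) = X (a' (n + 1)) := fun n => by
    rw [hD, Derivation.add_apply, shift_X_self ha', shift_X_of_ne fun k => haa' k n, zero_add]
  have haD : ∀ n g, pderiv (a (n + 1)) (D g) = D (pderiv (a (n + 1)) g) + pderiv (a n) g := by
    rw [hD]
    exact pderiv_shift_add_shift ha ha' haa'
  have ha'D : ∀ n g,
      pderiv (a' (n + 1)) (D g) = D (pderiv (a' (n + 1)) g) + pderiv (a' n) g := by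
    rw [hD, add_comm]
    exact pderiv_shift_add_shift ha' ha fun m n => (haa' n m).symm
  have h0 : ∀ i j, D (pderiv (a i) (pderiv (c j) f)) = 0 := fun i j =>
    derivation_eq_zero_of_mem_Psub hDp (hf i j)
  have h0' : ∀ i j, D (pderiv (a' i) (pderiv (c' j) f)) = 0 := fun i j =>
    derivation_eq_zero_of_mem_Psub hDp (hf' i j)
  rw [Lam_derivation hc D hDc hDp hcD hpD, Lam_derivation hc' D hDc' hDp hc'D hpD]
  simp only [map_add, Derivation.map_smul,
    ← mixed_derivation ha hc D hDa' hDc' haD hcD h0,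
    ← mixed_derivation ha' hc' D hDa hDc ha'D hc'D h0',
    ← mixed_derivation ha' hc' D hDa' hDc' ha'D hc'D h0', smul_sub]
  abel

/-- **Commutators with the shift operators** (relations (4.7c)–(4.7d) of Chapuy–Dołęga):
`[Λ_Z̃, Ỹ_+] = Ỹ_+ Δ` and `[Λ_Ỹ, Z̃_+] = Z̃_+ Δ` on `𝒫_{Ỹ,Z̃}`. -/
theorem commutators_with_shifts :
    ∀ f ∈ PYZt,
      (LamZt (Ytplus f) - Ytplus (LamZt f) = Ytplus (Delta f)) ∧
      (LamYt (Ztplus f) - Ztplus (LamYt f) = Ztplus (Delta f)) := by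
  intro f hf
  have hY : ∀ g, Ytplus g = (shift Var.y + shift Var.y') g := fun g => by
    rw [Ytplus, plus_eq_shift fun _ => rfl, plus_eq_shift fun _ => rfl, Derivation.add_apply]
  have hZ : ∀ g, Ztplus g = (shift Var.z + shift Var.z') g := fun g => by
    rw [Ztplus, plus_eq_shift fun _ => rfl, plus_eq_shift fun _ => rfl, Derivation.add_apply]
  constructor
  · rw [hY, hY, hY, LamZt, LamZt, MZ_eq_mixed, MZ_eq_mixed, Delta_eq_crossed]
    refine commutator_with_shift ?_ ?_ ?_ ?_ ?_ ?_ ?_ ?_ ?_ ?_ ?_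
      (fun i j => (pderiv_pderiv_mem_Psub hf i j).1)
      (fun i j => (pderiv_pderiv_mem_Psub hf i j).2) _ rfl <;> simp [Var.idx]
  · rw [hZ, hZ, hZ, LamYt, LamYt, MY_eq_mixed, MY_eq_mixed, Delta_eq_crossed_swap]
    refine commutator_with_shift ?_ ?_ ?_ ?_ ?_ ?_ ?_ ?_ ?_ ?_ ?_
      (fun i j => pderiv_pderiv_comm _ _ f ▸ (pderiv_pderiv_mem_Psub hf j i).1)
      (fun i j => pderiv_pderiv_comm _ _ f ▸ (pderiv_pderiv_mem_Psub hf j i).2) _ rfl <;>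
    simp [Var.idx]
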